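/- arXiv:0910.3087 — 2 statements merged into one kernel-verified Lean document; each statement's English description precedes it below -/
import Mathlib

section
/- Let a, b ∈ ℂ and suppose neither 2a nor a + 1/2 is a nonpositive integer. Then there is an open neighborhood U of 0 in ℂ such that for all x ∈ U, ₂F₁(a, b; 2a; x(2-x)) = (1 - x)^(-b) · ₂F₁(2a - b, b; a + 1/2; x²/(4(x-1))). -/
open Complex Filter Topology

lemma uniq_aux (f p q r : ℂ → ℂ) (hf : AnalyticAt ℂ f 0) (hp : ContinuousAt p 0)
    (hq : ContinuousAt q 0) (hr : ContinuousAt r 0) (h0 : f 0 = 0)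
    (hpq : ∀ n : ℕ, n * p 0 + q 0 ≠ 0)
    (hode : ∀ᶠ x in 𝓝[≠] (0:ℂ), x * p x * deriv (deriv f) x + q x * deriv f x + r x * f x = 0) :
    ∀ᶠ x in 𝓝 (0:ℂ), f x = 0 := by
  by_contra hne
  obtain ⟨n, g, hg, hg0, hfg⟩ := hf.exists_eventuallyEq_pow_smul_nonzero_iff.mpr hne
  obtain _ | m := n
  · have := hfg.self_of_nhds
    simp [h0] at this
    exact hg0 this.symm
  have hfg1 : f =ᶠ[𝓝 0] fun x => x^(m+1) * g x := by
    filter_upwards [hfg] with x hx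
    simpa using hx
  set h : ℂ → ℂ := fun x => (m+1) * g x + x * deriv g x with hh
  have hha : AnalyticAt ℂ h 0 := by
    have := hg.deriv
    fun_prop
  have hf1 : deriv f =ᶠ[𝓝 0] fun x => x^m * h x := by
    refine hfg1.deriv.trans ?_
    filter_upwards [hg.eventually_analyticAt] with x hx
    have := ((hasDerivAt_pow (m+1) x).mul hx.differentiableAt.hasDerivAt).deriv
    refine this.trans ?_
    simp [hh]; ring
  have hf2 : ∀ᶠ x in 𝓝 (0:ℂ), x * deriv (deriv f) x = x^m * (m * h x + x * deriv h x) := by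
    filter_upwards [hf1.deriv, hha.eventually_analyticAt] with x hx1 hx
    have := ((hasDerivAt_pow m x).mul hx.differentiableAt.hasDerivAt).deriv
    rw [hx1]
    refine (congrArg (x * ·) this).trans ?_
    cases m with
    | zero => simp
    | succ k => simp; ring
  set B : ℂ → ℂ := fun x => p x * (m * h x + x * deriv h x) + q x * h x + r x * (x * g x) with hB
  have hBz : ∀ᶠ x in 𝓝[≠] (0:ℂ), B x = 0 := by
    filter_upwards [hode, hf2.filter_mono nhdsWithin_le_nhds, hf1.filter_mono nhdsWithin_le_nhds,
      hfg1.filter_mono nhdsWithin_le_nhds, self_mem_nhdsWithin] with x h1 h2 h3 h4 h5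
    have hx : x ^ m ≠ 0 := pow_ne_zero _ h5
    apply mul_left_cancel₀ hx
    rw [h3, h4] at h1
    simp only [hB]
    linear_combination h1 - p x * h2
  have hBc : ContinuousAt B 0 := by
    have := hha.deriv.continuousAt
    have := hha.continuousAt
    have := hg.continuousAt
    fun_prop
  have hB0 : B 0 = 0 :=
    tendsto_nhds_unique (hBc.tendsto.mono_left nhdsWithin_le_nhds)
      (tendsto_const_nhds.congr' (hBz.mono fun x hx => hx.symm))
  have : ((m:ℂ) * p 0 + q 0) * ((m + 1) * g 0) = 0 := by
    simp [hB, hh] at hB0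
    linear_combination hB0
  have hm : (m:ℂ) + 1 ≠ 0 := by exact_mod_cast m.succ_ne_zero
  exact mul_ne_zero (hpq m) (mul_ne_zero hm hg0) this

lemma theta_aux (u : ℕ → ℂ) (f : ℂ → ℂ) (R : ℝ)
    (hs : ∀ z ∈ Metric.ball (0:ℂ) R, HasSum (fun n => u n * z^n) (f z)) :
    ∀ z ∈ Metric.ball (0:ℂ) R, HasSum (fun n => (n * u n) * z^n) (z * deriv f z) := by
  intro z hz
  obtain ⟨ρ, h1, h2⟩ := exists_between (mem_ball_zero_iff.mp hz)
  have hρ : 0 < ρ := (norm_nonneg _).trans_lt h1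
  have hsum : Summable fun n => ‖u n * (ρ:ℂ)^n‖ :=
    (hs ρ (by simpa [abs_of_pos hρ] using h2)).summable.norm
  have key := Complex.hasSum_deriv_of_summable_norm (F := fun n w => u n * w^n) (U := Metric.ball 0 ρ)
    hsum (fun i => by fun_prop) Metric.isOpen_ball (fun i w hw => by
      rw [norm_mul, norm_mul, norm_pow, norm_pow]
      have : ‖w‖ ≤ ‖(ρ:ℂ)‖ := by
        simpa [abs_of_pos hρ] using (mem_ball_zero_iff.mp hw).le
      gcongr) (mem_ball_zero_iff.mpr h1)
  have he : (fun w => ∑' i, u i * w^i) =ᶠ[𝓝 z] f := by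
    filter_upwards [Metric.isOpen_ball.mem_nhds hz] with w hw
    exact (hs w hw).tsum_eq
  rw [he.deriv_eq] at key
  have e : (fun n : ℕ => ((n:ℂ) * u n) * z^n)
      = fun n : ℕ => z * deriv (fun w : ℂ => u n * w^n) z := ?_
  · rw [e]; exact key.mul_left z
  funext n
  have : deriv (fun w : ℂ => u n * w^n) z = u n * (n * z^(n-1)) :=
    ((hasDerivAt_pow n z).const_mul (u n)).deriv
  rw [this]
  cases n with
  | zero => simp
  | succ k => simp; ring

lemma hyp_radius (a b c : ℂ) (hc : ∀ n : ℕ, c ≠ -(n:ℂ)) :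
    1 ≤ (ordinaryHypergeometricSeries ℂ a b c).radius := by
  by_cases h1 : ∃ k : ℕ, a = -(k:ℂ)
  · obtain ⟨k, rfl⟩ := h1
    simp [ordinaryHypergeometric_radius_top_of_neg_nat₁]
  by_cases h2 : ∃ k : ℕ, b = -(k:ℂ)
  · obtain ⟨k, rfl⟩ := h2
    simp [ordinaryHypergeometric_radius_top_of_neg_nat₂]
  push Not at h1 h2
  rw [ordinaryHypergeometricSeries_radius_eq_one]
  intro k
  refine ⟨fun h => h1 k ?_, fun h => h2 k ?_, fun h => hc k ?_⟩ <;> rw [h] <;> simp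

lemma hyp_mem (a b c : ℂ) (hc : ∀ n : ℕ, c ≠ -(n:ℂ)) (z : ℂ) (hz : z ∈ Metric.ball (0:ℂ) 1) :
    z ∈ Metric.eball (0:ℂ) (ordinaryHypergeometricSeries ℂ a b c).radius := by
  refine Metric.eball_subset_eball (hyp_radius a b c hc) ?_
  rw [← ENNReal.ofReal_one, Metric.eball_ofReal]
  exact hz

lemma hyp_hasSum (a b c : ℂ) (hc : ∀ n : ℕ, c ≠ -(n:ℂ)) :
    ∀ z ∈ Metric.ball (0:ℂ) 1,
      HasSum (fun n => ordinaryHypergeometricCoefficient a b c n * z^n)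
        (ordinaryHypergeometric a b c z) := by
  intro z hz
  have := (ordinaryHypergeometricSeries ℂ a b c).hasSum (hyp_mem a b c hc z hz)
  simp only [ordinaryHypergeometricSeries_apply_eq, smul_eq_mul] at this
  exact this

lemma hyp_analytic (a b c : ℂ) (hc : ∀ n : ℕ, c ≠ -(n:ℂ)) :
    AnalyticOnNhd ℂ (ordinaryHypergeometric a b c) (Metric.ball (0:ℂ) 1) := by
  intro z hz
  exact ((ordinaryHypergeometricSeries ℂ a b c).hasFPowerSeriesOnBall
    (zero_lt_one.trans_le (hyp_radius a b c hc))).analyticAt_of_mem (hyp_mem a b c hc z hz)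

lemma hyp_ode (a b c : ℂ) (hc : ∀ n : ℕ, c ≠ -(n:ℂ)) (z : ℂ) (hz : z ∈ Metric.ball (0:ℂ) 1)
    (hz0 : z ≠ 0) :
    z * (1 - z) * deriv (deriv (ordinaryHypergeometric a b c)) z
      + (c - (a + b + 1) * z) * deriv (ordinaryHypergeometric a b c) z
      - a * b * ordinaryHypergeometric a b c z = 0 := by
  set F : ℂ → ℂ := ordinaryHypergeometric a b c with hF
  set u := ordinaryHypergeometricCoefficient a b c with hu
  have s0 := hyp_hasSum a b c hc
  have s1 := theta_aux _ _ _ s0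
  have s2 := theta_aux _ _ _ s1 z hz
  replace s0 := s0 z hz
  replace s1 := s1 z hz
  have hd : deriv (fun z => z * deriv F z) z = deriv F z + z * deriv (deriv F) z := by
    have := ((hasDerivAt_id z).mul
      (hyp_analytic a b c hc z hz).deriv.differentiableAt.hasDerivAt).deriv
    refine Eq.trans ?_ (this.trans (by simp [hF]))
    rfl
  rw [hd] at s2
  have hrec : ∀ n : ℕ, u (n+1) * ((n+1) * (n + c)) = u n * ((n + a) * (n + b)) := by
    intro n
    have hcn : c + n ≠ 0 := fun h => hc n (eq_neg_of_add_eq_zero_left h)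
    have hP : (ascPochhammer ℂ n).eval c ≠ 0 := by
      intro h
      rw [ascPochhammer_eval_eq_zero_iff] at h
      obtain ⟨k, -, hk⟩ := h
      exact hc k (by rw [hk]; simp)
    have hn : (n:ℂ) + 1 ≠ 0 := by exact_mod_cast n.succ_ne_zero
    have hf : ((n.factorial : ℕ) : ℂ) ≠ 0 := by exact_mod_cast n.factorial_ne_zero
    simp only [hu, ordinaryHypergeometricCoefficient, ascPochhammer_succ_eval, Nat.factorial_succ]
    push_cast
    field_simp
    ring
  have hL := (s2.add (s1.mul_left (c - 1)))
  have hR := ((s2.add (s1.mul_left (a + b))).add (s0.mul_left (a * b))).mul_left z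
  rw [← hasSum_nat_add_iff' 1] at hL
  have hR' : HasSum (fun n : ℕ => (((n + 1 : ℕ) : ℂ) * (((n + 1 : ℕ) : ℂ) * u (n + 1))) * z ^ (n + 1)
      + (c - 1) * ((((n + 1 : ℕ) : ℂ) * u (n + 1)) * z ^ (n + 1)))
      (z * (z * (deriv F z + z * deriv (deriv F) z) + (a + b) * (z * deriv F z)
        + a * b * F z)) := by
    refine Eq.mp (congrArg (fun f => HasSum f _) ?_) hR
    funext n
    symm
    change _ = z * (n * (n * u n) * z ^ n + (a + b) * (n * u n * z ^ n) + a * b * (u n * z ^ n))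
    push_cast
    linear_combination z^(n+1) * hrec n
  have := hL.unique hR'
  simp at this
  apply mul_left_cancel₀ hz0
  linear_combination this

lemma alg_G (a b x F0 F1 F2 : ℂ)
    (h : (x*(2-x)) * (1 - x*(2-x)) * F2 + (2*a - (a + b + 1) * (x*(2-x))) * F1 - a * b * F0 = 0) :
    x * ((2-x)*(1-x)) * (F2 * (2-2*x) * (2-2*x) + F1 * (-2))
      + (x*(2-x) + 2*(2*a-(a+b+1)*(x*(2-x)))) * (F1 * (2-2*x)) + (-4*a*b*(1-x)) * F0 = 0 := by
  linear_combination 4 * (1-x) * h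

lemma alg_H (a b x E K0 K1 K2 : ℂ) (hx : x - 1 ≠ 0)
    (h : (x^2/(4*(x-1))) * (1 - x^2/(4*(x-1))) * K2
      + (a + 1/2 - (2*a - b + b + 1) * (x^2/(4*(x-1)))) * K1 - (2*a-b) * b * K0 = 0) :
    x * ((2-x)*(1-x)) * ((-b/(x-1)*E) * (-b/(x-1) * K0 + K1 * (x*(x-2)/(4*(x-1)^2)))
        + E * ((b/(x-1)^2 * K0 + -b/(x-1) * (K1 * (x*(x-2)/(4*(x-1)^2))))
          + (K2 * (x*(x-2)/(4*(x-1)^2)) * (x*(x-2)/(4*(x-1)^2)) + K1 * (1/(2*(x-1)^3)))))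
      + (x*(2-x) + 2*(2*a-(a+b+1)*(x*(2-x))))
        * (E * (-b/(x-1) * K0 + K1 * (x*(x-2)/(4*(x-1)^2))))
      + (-4*a*b*(1-x)) * (E * K0) = 0 := by
  linear_combination (norm := skip) (E * x*(2-x)/(x-1)) * h
  field_simp
  ring

lemma deriv_G (F : ℂ → ℂ) (hF : AnalyticOnNhd ℂ F (Metric.ball (0:ℂ) 1)) (x : ℂ)
    (hx : x*(2-x) ∈ Metric.ball (0:ℂ) 1) :
    HasDerivAt (fun x => F (x*(2-x))) (deriv F (x*(2-x)) * (2-2*x)) x := by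
  have hz : HasDerivAt (fun x : ℂ => x*(2-x)) (2-2*x) x := by
    refine ((hasDerivAt_id x).mul ((hasDerivAt_id x).const_sub 2)).congr_deriv ?_
    simp; ring
  exact HasDerivAt.comp x (hF _ hx).differentiableAt.hasDerivAt hz

lemma deriv_w (x : ℂ) (hx : x - 1 ≠ 0) :
    HasDerivAt (fun x : ℂ => x^2/(4*(x-1))) (x*(x-2)/(4*(x-1)^2)) x := by
  refine ((hasDerivAt_pow 2 x).div (((hasDerivAt_id x).sub_const 1).const_mul 4)
    (mul_ne_zero (by norm_num : (4:ℂ) ≠ 0) hx)).congr_deriv ?_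
  simp; field_simp; ring

lemma deriv_w1 (x : ℂ) (hx : x - 1 ≠ 0) :
    HasDerivAt (fun x : ℂ => x*(x-2)/(4*(x-1)^2)) (1/(2*(x-1)^3)) x := by
  refine (((hasDerivAt_id x).mul ((hasDerivAt_id x).sub_const 2)).div
    ((((hasDerivAt_id x).sub_const 1).pow 2).const_mul 4)
    (mul_ne_zero (by norm_num : (4:ℂ) ≠ 0) (pow_ne_zero 2 hx))).congr_deriv ?_
  simp; field_simp; ring

lemma deriv_bx (b x : ℂ) (hx : x - 1 ≠ 0) :
    HasDerivAt (fun x : ℂ => -b/(x-1)) (b/(x-1)^2) x := by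
  refine ((hasDerivAt_const x (-b)).div ((hasDerivAt_id x).sub_const 1) hx).congr_deriv ?_
  simp

lemma deriv_E (b x : ℂ) (hx : 1 - x ∈ slitPlane) :
    HasDerivAt (fun x : ℂ => (1-x)^(-b)) (-b/(x-1) * (1-x)^(-b)) x := by
  have h0 : 1 - x ≠ 0 := slitPlane_ne_zero hx
  have h1 : x - 1 ≠ 0 := fun h => h0 (by linear_combination -h)
  refine (((hasDerivAt_id x).const_sub 1).cpow_const (c := -b) hx).congr_deriv ?_
  rw [show id x = x from rfl, cpow_sub _ _ h0, cpow_one]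
  field_simp
  ring

theorem stmt3 (a b : ℂ) (hc1 : ∀ n : ℕ, 2*a ≠ -(n : ℂ))
    (hc2 : ∀ n : ℕ, a + 1/2 ≠ -(n : ℂ)) :
    ∃ U : Set ℂ, IsOpen U ∧ (0 : ℂ) ∈ U ∧ ∀ x ∈ U,
      ordinaryHypergeometric a b (2*a) (x*(2-x)) =
        (1 - x) ^ (-b) * ordinaryHypergeometric (2*a - b) b (a + 1/2) (x^2 / (4*(x-1))) := by
  have oF := hyp_ode a b (2*a) hc1
  have oK := hyp_ode (2*a-b) b (a+1/2) hc2
  have aF := hyp_analytic a b (2*a) hc1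
  have aK := hyp_analytic (2*a-b) b (a+1/2) hc2
  have hF0 : ordinaryHypergeometric a b (2*a) (0:ℂ) = 1 := ordinaryHypergeometric_zero _ _ _
  have hK0 : ordinaryHypergeometric (2*a-b) b (a+1/2) (0:ℂ) = 1 := ordinaryHypergeometric_zero _ _ _
  generalize (ordinaryHypergeometric a b (2*a) : ℂ → ℂ) = F at *
  generalize (ordinaryHypergeometric (2*a-b) b (a+1/2) : ℂ → ℂ) = K at *
  set G : ℂ → ℂ := fun x => F (x*(2-x)) with hG
  set w : ℂ → ℂ := fun x => x^2/(4*(x-1)) with hw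
  set H : ℂ → ℂ := fun x => (1-x)^(-b) * K (w x) with hH
  have e1 : ∀ᶠ x : ℂ in 𝓝 0, x*(2-x) ∈ Metric.ball (0:ℂ) 1 := by
    have : ContinuousAt (fun x : ℂ => x*(2-x)) 0 := by fun_prop
    exact this.eventually_mem (Metric.isOpen_ball.mem_nhds (by simp))
  have e2 : ∀ᶠ x : ℂ in 𝓝 0, w x ∈ Metric.ball (0:ℂ) 1 := by
    have : ContinuousAt w 0 := (deriv_w 0 (by simp)).continuousAt
    exact this.eventually_mem (Metric.isOpen_ball.mem_nhds (by simp [hw]))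
  have e3 : ∀ᶠ x : ℂ in 𝓝 0, 1 - x ∈ slitPlane := by
    have : ContinuousAt (fun x : ℂ => 1 - x) 0 := by fun_prop
    exact this.eventually_mem (isOpen_slitPlane.mem_nhds (by simp))
  have e4 : ∀ᶠ x : ℂ in 𝓝 0, x ≠ 2 := isOpen_ne.eventually_mem (by simp)
  have ne1 : ∀ x : ℂ, 1 - x ∈ slitPlane → x - 1 ≠ 0 := fun x hx h =>
    slitPlane_ne_zero hx (by linear_combination -h)
  have dG : ∀ᶠ x in 𝓝 (0:ℂ), HasDerivAt G (deriv F (x*(2-x)) * (2-2*x)) x := by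
    filter_upwards [e1] with x hx using deriv_G F aF x hx
  have dH : ∀ᶠ x in 𝓝 (0:ℂ), HasDerivAt H ((1-x)^(-b) *
      (-b/(x-1) * K (w x) + deriv K (w x) * (x*(x-2)/(4*(x-1)^2)))) x := by
    filter_upwards [e2, e3] with x h2 h3
    have hk : HasDerivAt (fun x => K (w x)) (deriv K (w x) * (x*(x-2)/(4*(x-1)^2))) x :=
      HasDerivAt.comp x (aK _ h2).differentiableAt.hasDerivAt (deriv_w x (ne1 x h3))
    refine ((deriv_E b x h3).mul hk).congr_deriv ?_
    ring
  have d2G : ∀ᶠ x in 𝓝 (0:ℂ), HasDerivAt (deriv G)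
      (deriv (deriv F) (x*(2-x)) * (2-2*x) * (2-2*x) + deriv F (x*(2-x)) * (-2)) x := by
    filter_upwards [e1, dG.eventually_nhds] with x hx hd
    have h1 := deriv_G (deriv F) aF.deriv x hx
    have h2 : HasDerivAt (fun x : ℂ => 2 - 2*x) (-2) x := by
      simpa using ((hasDerivAt_id x).const_mul 2).const_sub 2
    exact (h1.mul h2).congr_of_eventuallyEq (hd.mono fun y hy => hy.deriv)
  have d2H : ∀ᶠ x in 𝓝 (0:ℂ), HasDerivAt (deriv H)
      ((-b/(x-1)*(1-x)^(-b)) * (-b/(x-1) * K (w x) + deriv K (w x) * (x*(x-2)/(4*(x-1)^2)))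
        + (1-x)^(-b) * ((b/(x-1)^2 * K (w x) + -b/(x-1) * (deriv K (w x) * (x*(x-2)/(4*(x-1)^2))))
          + (deriv (deriv K) (w x) * (x*(x-2)/(4*(x-1)^2)) * (x*(x-2)/(4*(x-1)^2))
            + deriv K (w x) * (1/(2*(x-1)^3))))) x := by
    filter_upwards [e2, e3, dH.eventually_nhds] with x h2 h3 hd
    have hx := ne1 x h3
    have hk : HasDerivAt (fun x => K (w x)) (deriv K (w x) * (x*(x-2)/(4*(x-1)^2))) x :=
      HasDerivAt.comp x (aK _ h2).differentiableAt.hasDerivAt (deriv_w x hx)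
    have hk1 : HasDerivAt (fun x => deriv K (w x))
        (deriv (deriv K) (w x) * (x*(x-2)/(4*(x-1)^2))) x :=
      HasDerivAt.comp x (aK.deriv _ h2).differentiableAt.hasDerivAt (deriv_w x hx)
    exact ((deriv_E b x h3).mul (((deriv_bx b x hx).mul hk).add (hk1.mul (deriv_w1 x hx)))
      ).congr_of_eventuallyEq (hd.mono fun y hy => hy.deriv)
  have key : ∀ᶠ x in 𝓝 (0:ℂ), G x - H x = 0 := by
    refine uniq_aux (fun x => G x - H x) (fun x => (2-x)*(1-x))
      (fun x => x*(2-x) + 2*(2*a-(a+b+1)*(x*(2-x)))) (fun x => -4*a*b*(1-x)) ?_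
      (by fun_prop) (by fun_prop) (by fun_prop) (by simp [hG, hH, hw, hF0, hK0]) ?_ ?_
    · rw [Complex.analyticAt_iff_eventually_differentiableAt]
      filter_upwards [dG, dH] with x h1 h2 using (h1.sub h2).differentiableAt
    · intro n h
      apply hc1 n
      simp at h
      linear_combination h / 2
    · have hd : deriv (fun x => G x - H x) =ᶠ[𝓝 0] fun x => deriv G x - deriv H x := by
        filter_upwards [dG, dH] with x h1 h2
        exact (h1.differentiableAt.hasDerivAt.sub h2.differentiableAt.hasDerivAt).deriv
      have hall := e1.and (e2.and (e3.and (e4.and (dG.and (dH.and (d2G.and (d2H.and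
        (hd.and hd.deriv))))))))
      filter_upwards [hall.filter_mono nhdsWithin_le_nhds, self_mem_nhdsWithin] with x hx hx0
      obtain ⟨h1, h2, h3, h4, h5, h6, h7, h8, h9, h10⟩ := hx
      have hx0 : x ≠ 0 := hx0
      have hx1 := ne1 x h3
      have hD : deriv (fun x => deriv G x - deriv H x) x = deriv (deriv G) x - deriv (deriv H) x :=
        (h7.differentiableAt.hasDerivAt.sub h8.differentiableAt.hasDerivAt).deriv
      rw [h10, hD, h9, h7.deriv, h8.deriv, h5.deriv, h6.deriv]
      have g := alg_G a b x _ _ _ (oF _ h1 (mul_ne_zero hx0 (sub_ne_zero.mpr h4.symm)))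
      have k := alg_H a b x ((1-x)^(-b)) _ _ _ hx1 (oK _ h2
        (div_ne_zero (pow_ne_zero 2 hx0) (mul_ne_zero (by norm_num : (4:ℂ) ≠ 0) hx1)))
      simp only [hG, hH, hw]
      linear_combination g - k
  obtain ⟨U, hU, hUo, h0⟩ := eventually_nhds_iff.mp key
  exact ⟨U, hUo, h0, fun x hx => sub_eq_zero.mp (hU x hx)⟩
end

section
/- Let a, b ∈ ℂ with a + b + 1/3 not a nonpositive integer. Then there is an open neighborhood U of 0 in ℂ such that the function g(x) = (1 - x)^(-2a) · ₂F₁(a, b; a+b+1/3; -x(x-9)²/(27(x-1)²)) satisfies Heun's differential equation with parameters (t, q; a', b'; c'; d') = (9, 18a² - 9ab + 6a; 3a, 2a+b; a+b+1/3; 2a-2b+1) at every x ∈ U with x ∉ {0, 1, 9}. -/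
open Complex

/-- `g` satisfies Heun's differential equation with parameters `(t, q; a, b; c; d)`
at the point `x`: `g` is twice complex differentiable at `x` and
`g''(x) + (c/x + d/(x-1) + (a+b-c-d+1)/(x-t)) g'(x) + ((a b x - q)/(x(x-1)(x-t))) g(x) = 0`. -/
def SatisfiesHeunAt (t q a b c d : ℂ) (g : ℂ → ℂ) (x : ℂ) : Prop :=
  DifferentiableAt ℂ g x ∧ DifferentiableAt ℂ (deriv g) x ∧
    deriv (deriv g) x +
      (c / x + d / (x - 1) + (a + b - c - d + 1) / (x - t)) * deriv g x +
      ((a * b * x - q) / (x * (x - 1) * (x - t))) * g x = 0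

lemma hg_radius (a b c : ℂ) (hc : ∀ n : ℕ, c ≠ -(n : ℂ)) :
    1 ≤ (ordinaryHypergeometricSeries ℂ a b c).radius := by
  by_cases ha : ∃ k : ℕ, a = -(k : ℂ)
  · obtain ⟨k, rfl⟩ := ha
    rw [ordinaryHypergeometric_radius_top_of_neg_nat₁]; exact le_top
  by_cases hb : ∃ k : ℕ, b = -(k : ℂ)
  · obtain ⟨k, rfl⟩ := hb
    rw [ordinaryHypergeometric_radius_top_of_neg_nat₂]; exact le_top
  push Not at ha hb
  rw [ordinaryHypergeometricSeries_radius_eq_one]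
  intro k
  refine ⟨fun h => ha k ?_, fun h => hb k ?_, fun h => hc k ?_⟩ <;> rw [h, neg_neg]

lemma hg_fps (a b c : ℂ) (hc : ∀ n : ℕ, c ≠ -(n : ℂ)) :
    HasFPowerSeriesOnBall (ordinaryHypergeometric a b c)
      (ordinaryHypergeometricSeries ℂ a b c) (0 : ℂ) 1 := by
  have h := hg_radius a b c hc
  exact ((ordinaryHypergeometricSeries ℂ a b c).hasFPowerSeriesOnBall
    (lt_of_lt_of_le one_pos h)).mono one_pos h

lemma hg_diff (a b c : ℂ) (hc : ∀ n : ℕ, c ≠ -(n : ℂ)) :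
    DifferentiableOn ℂ (ordinaryHypergeometric a b c : ℂ → ℂ) (Metric.ball 0 1) := by
  have h := (hg_fps a b c hc).differentiableOn
  rwa [← ENNReal.ofReal_one, Metric.eball_ofReal] at h

lemma hg_iter (a b c : ℂ) (hc : ∀ n : ℕ, c ≠ -(n : ℂ)) (n : ℕ) :
    iteratedDeriv n (ordinaryHypergeometric a b c : ℂ → ℂ) 0
      = (n.factorial : ℂ) * ordinaryHypergeometricCoefficient a b c n := by
  have h := (hg_fps a b c hc).hasFPowerSeriesAt
  have h2 := h.eq_formalMultilinearSeries (h.analyticAt.hasFPowerSeriesAt)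
  have h3 := congrArg (fun p => p.coeff n) h2
  simp only [ordinaryHypergeometricSeries, FormalMultilinearSeries.coeff_ofScalars] at h3
  rw [h3]
  have : (n.factorial : ℂ) ≠ 0 := by exact_mod_cast n.factorial_ne_zero
  field_simp

lemma hasSum_shift (v : ℕ → ℂ) (z S : ℂ) (h0 : v 0 = 0)
    (h : HasSum (fun n => v (n+1) * z^n) S) : HasSum (fun n => v n * z^n) (z * S) := by
  rw [← hasSum_nat_add_iff' 1]
  convert! h.mul_left z using 1
  · ext n; rw [pow_succ]; ring
  · rw [Finset.sum_range_one, h0]; ring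

lemma coeff_rec (a b c : ℂ) (hc : ∀ n : ℕ, c ≠ -(n : ℂ)) (n : ℕ) :
    ((n : ℂ) + 1) * (c + n) * ordinaryHypergeometricCoefficient a b c (n+1)
      = (a + n) * (b + n) * ordinaryHypergeometricCoefficient a b c n := by
  have h1 : (n : ℂ) + 1 ≠ 0 := by exact_mod_cast n.succ_ne_zero
  have h2 : c + n ≠ 0 := fun h => hc n (eq_neg_of_add_eq_zero_left h)
  simp only [ordinaryHypergeometricCoefficient, ascPochhammer_succ_eval, Nat.factorial_succ,
    Nat.cast_mul, Nat.cast_add, Nat.cast_one, mul_inv]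
  field_simp

lemma hg_ode (a b c : ℂ) (hc : ∀ n : ℕ, c ≠ -(n : ℂ)) (z : ℂ) (hz : z ∈ Metric.ball (0:ℂ) 1) :
    z * (1 - z) * deriv (deriv (ordinaryHypergeometric a b c : ℂ → ℂ)) z
      + (c - (a + b + 1) * z) * deriv (ordinaryHypergeometric a b c : ℂ → ℂ) z
      - a * b * ordinaryHypergeometric a b c z = 0 := by
  set F : ℂ → ℂ := ordinaryHypergeometric a b c with hF
  obtain ⟨u, hit, hrec⟩ : ∃ u : ℕ → ℂ,
      (∀ n, iteratedDeriv n F 0 = (n.factorial : ℂ) * u n) ∧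
      (∀ n : ℕ, ((n : ℂ) + 1) * (c + n) * u (n+1) = (a + n) * (b + n) * u n) :=
    ⟨ordinaryHypergeometricCoefficient a b c, hg_iter a b c hc, coeff_rec a b c hc⟩
  have d0 : DifferentiableOn ℂ F (Metric.ball 0 1) := hg_diff a b c hc
  have d1 := d0.deriv Metric.isOpen_ball
  have d2 := d1.deriv Metric.isOpen_ball
  have hf (n : ℕ) : (n.factorial : ℂ) ≠ 0 := by exact_mod_cast n.factorial_ne_zero
  have s0 : HasSum (fun n : ℕ => u n * z^n) (F z) := by
    convert! hasSum_taylorSeries_on_ball d0 hz using 2 with n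
    rw [hit, smul_eq_mul, smul_eq_mul, sub_zero]
    have := hf n
    field_simp
  have s1 : HasSum (fun n : ℕ => ((n:ℂ)+1) * u (n+1) * z^n) (deriv F z) := by
    convert! hasSum_taylorSeries_on_ball d1 hz using 2 with n
    rw [← iteratedDeriv_succ', hit, smul_eq_mul, smul_eq_mul, sub_zero,
      Nat.factorial_succ]
    have := hf n
    push_cast
    field_simp
  have s2 : HasSum (fun n : ℕ => ((n:ℂ)+1) * ((n:ℂ)+2) * u (n+2) * z^n) (deriv (deriv F) z) := by
    convert! hasSum_taylorSeries_on_ball d2 hz using 2 with n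
    rw [← iteratedDeriv_succ', ← iteratedDeriv_succ', hit, smul_eq_mul, smul_eq_mul,
      sub_zero, Nat.factorial_succ, Nat.factorial_succ]
    have := hf n
    push_cast
    field_simp
    ring
  have t1 : HasSum (fun n : ℕ => ((n:ℂ)) * u n * z^n) (z * deriv F z) :=
    hasSum_shift (fun n : ℕ => (n:ℂ) * u n) z _ (by simp) (by push_cast; exact s1)
  have t2 : HasSum (fun n : ℕ => ((n:ℂ)) * ((n:ℂ)+1) * u (n+1) * z^n) (z * deriv (deriv F) z) :=
    hasSum_shift (fun n : ℕ => (n:ℂ) * ((n:ℂ)+1) * u (n+1)) z _ (by simp) (by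
      convert! s2 using 3 with n
      push_cast; ring)
  have t3 : HasSum (fun n : ℕ => ((n:ℂ)) * ((n:ℂ)-1) * u n * z^n)
      (z * (z * deriv (deriv F) z)) :=
    hasSum_shift (fun n : ℕ => (n:ℂ) * ((n:ℂ)-1) * u n) z _ (by simp) (by
      convert! t2 using 3 with n
      push_cast; ring)
  have key := ((((t2.sub t3).add (s1.mul_left c)).sub (t1.mul_left (a+b+1))).sub
    (s0.mul_left (a*b)))
  have hz0 : HasSum (fun _ : ℕ => (0:ℂ)) 0 := hasSum_zero
  have := key.unique (by
    convert! hz0 using 2 with n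
    have := hrec n
    linear_combination z^n * this)
  linear_combination this

lemma hasDerivAt_Z (x : ℂ) (h1 : x - 1 ≠ 0) :
    HasDerivAt (fun x : ℂ => -(x*(x-9)^2) / (27*(x-1)^2))
      (-((x-9)*(x+3)^2) / (27*(x-1)^3)) x := by
  have hx := hasDerivAt_id' x
  have hn := (hx.mul ((hx.sub_const 9).pow 2)).neg
  have hd := ((hx.sub_const 1).pow 2).const_mul 27
  have := hn.div hd (by simp [h1])
  convert! this using 1
  simp
  field_simp
  ring

lemma hasDerivAt_Z1 (x : ℂ) (h1 : x - 1 ≠ 0) :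
    HasDerivAt (fun x : ℂ => -((x-9)*(x+3)^2) / (27*(x-1)^3))
      (-(96*(x+3)) / (27*(x-1)^4)) x := by
  have hx := hasDerivAt_id' x
  have hn := ((hx.sub_const 9).mul ((hx.add_const 3).pow 2)).neg
  have hd := ((hx.sub_const 1).pow 3).const_mul 27
  have := hn.div hd (by simp [h1])
  convert! this using 1
  simp
  field_simp
  ring

lemma hasDerivAt_P (a x : ℂ) (h1 : 1 - x ∈ slitPlane) :
    HasDerivAt (fun x : ℂ => (1 - x) ^ (-(2*a)))
      ((-(2*a)/(x-1)) * (1 - x) ^ (-(2*a))) x := by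
  have hx := ((hasDerivAt_id' x).const_sub 1).cpow_const (c := -(2*a)) h1
  have h0 : 1 - x ≠ 0 := slitPlane_ne_zero h1
  have h0' : x - 1 ≠ 0 := fun h => h0 (by linear_combination -h)
  convert! hx using 1
  rw [cpow_sub _ _ h0, cpow_one]
  field_simp
  ring

theorem stmt16 (a b : ℂ) (hc : ∀ n : ℕ, a + b + 1/3 ≠ -(n : ℂ)) :
    ∃ U : Set ℂ, IsOpen U ∧ (0 : ℂ) ∈ U ∧ ∀ x ∈ U, x ≠ (0 : ℂ) → x ≠ (1 : ℂ) → x ≠ (9 : ℂ) →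
      SatisfiesHeunAt (9) (18*a^2 - 9*a*b + 6*a) (3*a) (2*a + b) (a + b + 1/3) (2*a - 2*b + 1)
        (fun x : ℂ => (1 - x) ^ (-(2*a)) * ordinaryHypergeometric a b (a + b + 1/3) (-(x*(x-9)^2) / (27*(x-1)^2))) x := by
  set F : ℂ → ℂ := ordinaryHypergeometric a b (a + b + 1/3) with hF
  have d0 : DifferentiableOn ℂ F (Metric.ball 0 1) := hg_diff a b _ hc
  have d1 := d0.deriv Metric.isOpen_ball
  have ode := hg_ode a b _ hc
  rw [← hF] at ode
  have hne : ∀ x ∈ Metric.ball (0:ℂ) 1, x - 1 ≠ 0 := by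
    intro x hx h
    rw [sub_eq_zero] at h
    simp [h] at hx
  have hslit : ∀ x ∈ Metric.ball (0:ℂ) 1, 1 - x ∈ slitPlane := by
    intro x hx
    rw [mem_ball_zero_iff] at hx
    left
    have := (Complex.re_le_norm x)
    simp
    linarith
  set Z : ℂ → ℂ := fun x => -(x*(x-9)^2) / (27*(x-1)^2) with hZ
  set Z1 : ℂ → ℂ := fun x => -((x-9)*(x+3)^2) / (27*(x-1)^3) with hZ1
  set P : ℂ → ℂ := fun x => (1 - x) ^ (-(2*a)) with hP
  have hcont : ContinuousOn Z (Metric.ball 0 1) := fun x hx =>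
    (hasDerivAt_Z x (hne x hx)).continuousAt.continuousWithinAt
  set U := Metric.ball (0:ℂ) 1 ∩ Z ⁻¹' Metric.ball 0 1 with hU
  have hUo : IsOpen U := hcont.isOpen_inter_preimage Metric.isOpen_ball Metric.isOpen_ball
  refine ⟨U, hUo, ⟨by simp, by simp [hZ]⟩, ?_⟩
  change ∀ x ∈ U, x ≠ 0 → x ≠ 1 → x ≠ 9 → SatisfiesHeunAt _ _ _ _ _ _
    (fun x => P x * F (Z x)) x
  have dF : ∀ z ∈ Metric.ball (0:ℂ) 1, HasDerivAt F (deriv F z) z := fun z hz =>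
    (d0.differentiableAt (Metric.isOpen_ball.mem_nhds hz)).hasDerivAt
  have dF1 : ∀ z ∈ Metric.ball (0:ℂ) 1, HasDerivAt (deriv F) (deriv (deriv F) z) z := fun z hz =>
    (d1.differentiableAt (Metric.isOpen_ball.mem_nhds hz)).hasDerivAt
  have dg : ∀ x ∈ U, HasDerivAt (fun x => P x * F (Z x))
      (P x * ((-(2*a)/(x-1)) * F (Z x) + Z1 x * deriv F (Z x))) x := by
    intro x hx
    convert! (hasDerivAt_P a x (hslit x hx.1)).mul
      ((dF (Z x) hx.2).comp x (hasDerivAt_Z x (hne x hx.1))) using 1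
    simp only [hP, hZ1, Function.comp]
    ring
  intro x hx h0 h1 h9
  have hx1 : x - 1 ≠ 0 := sub_ne_zero.2 h1
  have hx9 : x - 9 ≠ 0 := sub_ne_zero.2 h9
  have hev : deriv (fun x => P x * F (Z x)) =ᶠ[nhds x]
      fun x => P x * ((-(2*a)/(x-1)) * F (Z x) + Z1 x * deriv F (Z x)) :=
    Filter.eventually_of_mem (hUo.mem_nhds hx) fun y hy => (dg y hy).deriv
  have dq : HasDerivAt (fun x : ℂ => -(2*a)/(x-1)) (2*a/(x-1)^2) x := by
    convert! (hasDerivAt_const x (-(2*a))).div ((hasDerivAt_id' x).sub_const 1) hx1 using 1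
    simp
  have dgg : HasDerivAt (fun x => P x * ((-(2*a)/(x-1)) * F (Z x) + Z1 x * deriv F (Z x)))
      (P x * ((-(2*a)/(x-1)) * ((-(2*a)/(x-1)) * F (Z x) + Z1 x * deriv F (Z x))
        + (2*a/(x-1)^2) * F (Z x) + (-(2*a)/(x-1)) * (deriv F (Z x) * Z1 x)
        + (-(96*(x+3)) / (27*(x-1)^4)) * deriv F (Z x)
        + Z1 x * (deriv (deriv F) (Z x) * Z1 x))) x := by
    have hFz := (dF (Z x) hx.2).comp x (hasDerivAt_Z x hx1)
    have hF1z := (dF1 (Z x) hx.2).comp x (hasDerivAt_Z x hx1)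
    convert! (hasDerivAt_P a x (hslit x hx.1)).mul
      ((dq.mul hFz).add ((hasDerivAt_Z1 x hx1).mul hF1z)) using 1
    simp only [hP, hZ1, Function.comp, Pi.add_apply, Pi.mul_apply]
    ring
  have dgg' := dgg.congr_of_eventuallyEq hev
  refine ⟨(dg x hx).differentiableAt, dgg'.differentiableAt, ?_⟩
  rw [dgg'.deriv, (dg x hx).deriv]
  have o := ode (Z x) hx.2
  beta_reduce
  generalize deriv (deriv F) (Z x) = f2 at *
  generalize deriv F (Z x) = f1 at *
  generalize F (Z x) = f0 at *
  generalize P x = p at *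
  simp only [hZ] at o
  simp only [hZ1]
  refine Eq.trans ?_ ((congrArg (fun w => p * (-(x+3)/(x*(x-1)^2)) * w) o).trans (mul_zero _))
  beta_reduce
  field_simp
  ring
end
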